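/- For n ≥ 4, let (D̃_n, S) be the affine Coxeter system with S = {s_0, s_1,…,s_n}, where m(s_0,s_2) = m(s_1,s_2) = 3, m(s_i,s_{i+1}) = 3 for 2 ≤ i ≤ n−3, m(s_{n−1},s_{n−2}) = m(s_n,s_{n−2}) = 3, and m = 2 for all other pairs of distinct generators. Then every proper parabolic subgroup of D̃_n is finite, χ̂_{D̃_n}(q) is a polynomial, and χ̂_{D̃_n}(q) = χ̂_{D_n}(q) + (−1)^n q^{n(n−1)} + Σ_{k=0}^{n} (−1)^k q^{k(k−1)} χ̂_{D_{n−k}}(q), where χ̂_{D_m}(q) is the modified characteristic polynomial of the finite Coxeter group of type D_m and χ̂_{D_i}(q) = 1 for i ≤ 1. -/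

import Mathlib

open Polynomial

namespace CoxeterCharPoly

variable {B W : Type*} [Group W] {M : CoxeterMatrix B}

/-- The left weak order on a Coxeter group. -/
def wle (cs : CoxeterSystem M W) (u w : W) : Prop :=
  cs.length w = cs.length (w * u⁻¹) + cs.length u

/-- The standard parabolic subgroup generated by `J ⊆ S`. -/
def parabolic (cs : CoxeterSystem M W) (J : Set B) : Subgroup W :=
  Subgroup.closure (cs.simple '' J)

/- The longest element of the parabolic subgroup `W_J` (junk value if there is
no element of maximal length). -/
open Classical in
noncomputable def w0 (cs : CoxeterSystem M W) (J : Set B) : W :=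
  if h : ∃ w ∈ parabolic cs J, ∀ u ∈ parabolic cs J, cs.length u ≤ cs.length w
  then h.choose else 1

/-- The right descent set of `w`, as a subset of `B`. -/
def rightDescents (cs : CoxeterSystem M W) (w : W) : Set B :=
  {i | cs.IsRightDescent w i}

/- `μ` is the Möbius function of the subposet `A` of the order `le`. -/
open Classical in
def IsMobiusOn {α : Type*} (le : α → α → Prop) (A : Set α) (μ : α → α → ℤ) : Prop :=
  ∀ a ∈ A, ∀ b ∈ A, le a b →
    (∑ᶠ t ∈ {t | t ∈ A ∧ le a t ∧ le t b}, μ a t) = if a = b then 1 else 0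

/-- The Coxeter matrix of affine type `D̃ₙ`: generators `s₀, s₁, …, s_n` with `m(s₀,s₂) = m(s₁,s₂) = 3`, `m(s_i,s_{i+1}) = 3` for `2 ≤ i ≤ n-3`, `m(s_{n-1},s_{n-2}) = m(s_n,s_{n-2}) = 3`, and `m = 2` for all other pairs -/
def tDmat (n : ℕ) : CoxeterMatrix (Fin (n + 1)) where
  M := Matrix.of fun i j =>
    if i = j then 1
    else if (max (i : ℕ) (j : ℕ) = 2 ∧ min (i : ℕ) (j : ℕ) ≤ 1) ∨ (min (i : ℕ) (j : ℕ) + 1 = max (i : ℕ) (j : ℕ) ∧ 2 ≤ min (i : ℕ) (j : ℕ) ∧ max (i : ℕ) (j : ℕ) + 2 ≤ n) ∨ (min (i : ℕ) (j : ℕ) + 2 = n ∧ (max (i : ℕ) (j : ℕ) + 1 = n ∨ max (i : ℕ) (j : ℕ) = n)) then 3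
    else 2
  isSymm := by
    ext i j
    simp only [Matrix.transpose_apply, Matrix.of_apply]
    by_cases h : i = j
    · subst h; rfl
    · rw [if_neg (Ne.symm h), if_neg h, min_comm, max_comm]
  diagonal := by intro i; simp
  off_diagonal := by
    intro i j h
    simp only [Matrix.of_apply, if_neg h]
    split <;> simp

/-- The Coxeter matrix of type `Dₙ` (with `D₂` consisting of two commuting generators):
generators `s₁, …, s_n` (here 0-indexed by `Fin n`), with `m(s_i, s_{i+1}) = 3` for
`1 ≤ i ≤ n-2`, `m(s_n, s_{n-2}) = 3` when `n ≥ 3`, and `m = 2` for all other pairs. -/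
def Dmat (n : ℕ) : CoxeterMatrix (Fin n) where
  M := Matrix.of fun i j =>
    if i = j then 1
    else if (min (i : ℕ) (j : ℕ) + 1 = max (i : ℕ) (j : ℕ) ∧ max (i : ℕ) (j : ℕ) + 2 ≤ n)
        ∨ (min (i : ℕ) (j : ℕ) + 3 = n ∧ max (i : ℕ) (j : ℕ) + 1 = n) then 3
    else 2
  isSymm := by
    ext i j
    simp only [Matrix.transpose_apply, Matrix.of_apply]
    by_cases h : i = j
    · subst h; rfl
    · rw [if_neg (Ne.symm h), if_neg h, min_comm, max_comm]
  diagonal := by intro i; simp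
  off_diagonal := by
    intro i j h
    simp only [Matrix.of_apply, if_neg h]
    split <;> simp

/-- The length of the longest element of the standard parabolic subgroup `W_J` of the
Coxeter group of type `Dₙ`. -/
noncomputable def lenD (n : ℕ) (J : Finset (Fin n)) : ℕ :=
  (Dmat n).toCoxeterSystem.length
    (w0 (Dmat n).toCoxeterSystem (↑J : Set (Fin n)))

/-- The modified characteristic polynomial `χ̂_{Dₙ}(q)` of the finite Coxeter group of
type `Dₙ`, with the convention `χ̂_{D_i}(q) = 1` for `i ≤ 1`. -/
noncomputable def chiD (n : ℕ) : Polynomial ℤ :=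
  if n ≤ 1 then 1
  else ∑ J : Finset (Fin n), (-1 : Polynomial ℤ) ^ J.card * X ^ lenD n J

/-- The modified characteristic polynomial of the affine Coxeter group associated to
`tDmat`: `χ̂(q) = Σ_{J ⊆ S, W_J finite} (-1)^|J| q^(ℓ(w0(J)))`. -/
noncomputable def chiAffD (n : ℕ) : Polynomial ℤ :=
  ∑ᶠ J ∈ {J : Finset (Fin (n + 1)) |
      ((parabolic (tDmat n).toCoxeterSystem (↑J : Set (Fin (n + 1)))) :
        Set (tDmat n).Group).Finite},
    (-1 : Polynomial ℤ) ^ J.card *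
      X ^ (tDmat n).toCoxeterSystem.length
        (w0 (tDmat n).toCoxeterSystem (↑J : Set (Fin (n + 1))))

section Parabolic

variable (cs : CoxeterSystem M W)

lemma simple_mem_parabolic {J : Set B} {i : B} (hi : i ∈ J) :
    cs.simple i ∈ parabolic cs J :=
  Subgroup.subset_closure ⟨i, hi, rfl⟩

lemma finite_setOf_length_le [Finite B] (N : ℕ) : {w : W | cs.length w ≤ N}.Finite := by
  refine ((List.finite_length_le B N).image cs.wordProd).subset ?_
  intro w hw
  obtain ⟨ω, hω, rfl⟩ := cs.exists_isReduced w
  exact ⟨ω, by simpa [← hω.eq] using hw, rfl⟩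

lemma w0_spec {J : Set B} (h : (parabolic cs J : Set W).Finite) :
    w0 cs J ∈ parabolic cs J ∧ ∀ u ∈ parabolic cs J, cs.length u ≤ cs.length (w0 cs J) := by
  have hex : ∃ w ∈ parabolic cs J, ∀ u ∈ parabolic cs J, cs.length u ≤ cs.length w :=
    Set.exists_max_image _ cs.length h ⟨1, one_mem (parabolic cs J)⟩
  rw [w0, dif_pos hex]
  exact hex.choose_spec

end Parabolic

section Extension

variable {B' : Type*}

lemma exists_comp_eq (f : B ↪ B') {J : Set B} {v : B → ℤ} (hv : ∀ i ∉ J, v i = 0) :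
    ∃ w : B' → ℤ, (∀ i ∉ f '' J, w i = 0) ∧ w ∘ f = v := by
  refine ⟨Function.extend f v 0, fun i hi => ?_, Function.extend_comp f.injective v 0⟩
  by_cases h : ∃ j, f j = i
  · obtain ⟨j, rfl⟩ := h
    rw [f.injective.extend_apply]
    exact hv j fun hj => hi ⟨j, hj, rfl⟩
  · rw [Function.extend_apply' _ _ _ h]; rfl

lemma comp_injOn (f : B ↪ B') (J : Set B) :
    Set.InjOn (fun v : B' → ℤ => v ∘ f) {v | ∀ i ∉ f '' J, v i = 0} := by
  intro v hv w hw h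
  ext i
  by_cases hi : i ∈ f '' J
  · obtain ⟨j, _, rfl⟩ := hi
    exact congrFun h j
  · rw [hv i hi, hw i hi]

end Extension

section SimplyLaced

variable (M)

/-- A Coxeter matrix is simply laced if all its entries are at most `3` (and finite). -/
def SimplyLaced : Prop := ∀ i j, M i j = 1 ∨ M i j = 2 ∨ M i j = 3

/-- The entries of the Cartan matrix of a simply laced Coxeter matrix. -/
def cartan (i j : B) : ℤ := if M i j = 1 then 2 else if M i j = 3 then -1 else 0

lemma cartan_symm (i j : B) : cartan M i j = cartan M j i := by
  simp only [cartan, M.symmetric i j]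

lemma cartan_self (i : B) : cartan M i i = 2 := by simp [cartan]

lemma cartan_nonpos {i j : B} (h : i ≠ j) : cartan M i j ≤ 0 := by
  have := M.off_diagonal i j h
  simp only [cartan]
  split_ifs <;> simp_all

variable [Fintype B]

/-- The coroot functional `v ↦ ⟨v, αᵢ⟩` on the root lattice. -/
def coroot (i : B) : (B → ℤ) →ₗ[ℤ] ℤ where
  toFun v := ∑ j, cartan M i j * v j
  map_add' v w := by simp [mul_add, Finset.sum_add_distrib]
  map_smul' c v := by
    simp only [Pi.smul_apply, smul_eq_mul, RingHom.id_apply, Finset.mul_sum]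
    exact Finset.sum_congr rfl fun _ _ => by ring

lemma coroot_apply (i : B) (v : B → ℤ) : coroot M i v = ∑ j, cartan M i j * v j := rfl

/-- The norm form `⟨v, v⟩` on the root lattice. -/
def normForm (v : B → ℤ) : ℤ := ∑ i, v i * coroot M i v

/-- The positive vectors of norm two supported on `J`. -/
def posRoots (J : Set B) : Set (B → ℤ) :=
  {v | (∀ i ∉ J, v i = 0) ∧ 0 ≤ v ∧ normForm M v = 2}

/-- The norm form is positive definite on vectors supported on `J`
(its values being even, it is then at least two on nonzero vectors). -/
def PosDefOn (J : Set B) : Prop :=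
  ∀ v : B → ℤ, (∀ i ∉ J, v i = 0) → v ≠ 0 → 2 ≤ normForm M v

lemma sum_mul_coroot_comm (v w : B → ℤ) :
    ∑ i, v i * coroot M i w = ∑ i, w i * coroot M i v := by
  simp only [coroot_apply, Finset.mul_sum]
  rw [Finset.sum_comm]
  refine Finset.sum_congr rfl fun i _ => Finset.sum_congr rfl fun j _ => ?_
  rw [cartan_symm M j i]
  ring

lemma normForm_sub (v w : B → ℤ) :
    normForm M (v - w) = normForm M v + normForm M w - 2 * ∑ i, v i * coroot M i w := by
  have h := sum_mul_coroot_comm M v w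
  simp only [normForm, map_sub, Pi.sub_apply, mul_sub, sub_mul, Finset.sum_sub_distrib]
  linarith

lemma eq_zero_or_eq_zero_of_normForm_eq_two {J : Set B} (hJ : PosDefOn M J) {v w : B → ℤ}
    (hv : ∀ i ∉ J, v i = 0) (hw : ∀ i ∉ J, w i = 0) (hvw : ∑ i, v i * coroot M i w ≤ 0)
    (h : normForm M (v - w) = 2) : v = 0 ∨ w = 0 := by
  by_contra! hne
  have h1 := hJ v hv hne.1
  have h2 := hJ w hw hne.2
  have h3 := normForm_sub M v w
  linarith

/-- In a positive definite simply laced root lattice, vectors of norm two have coordinates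
of constant sign. -/
lemma nonneg_or_nonpos_of_normForm_eq_two {J : Set B} (hJ : PosDefOn M J) {v : B → ℤ}
    (hv : ∀ i ∉ J, v i = 0) (h : normForm M v = 2) : 0 ≤ v ∨ v ≤ 0 := by
  have hdecomp : v⁺ - v⁻ = v := posPart_sub_negPart v
  have key : v⁺ = 0 ∨ v⁻ = 0 := by
    refine eq_zero_or_eq_zero_of_normForm_eq_two M hJ ?_ ?_ ?_ (by rw [hdecomp, h])
    · intro i hi; simp [hv i hi]
    · intro i hi; simp [hv i hi]
    · simp only [coroot_apply, Finset.mul_sum]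
      refine Finset.sum_nonpos fun i _ => Finset.sum_nonpos fun j _ => ?_
      have h1 : 0 ≤ v⁺ i := posPart_nonneg v i
      have h2 : 0 ≤ v⁻ j := negPart_nonneg v j
      by_cases hij : i = j
      · subst hij
        have : v⁺ i * v⁻ i = 0 := by
          simp only [Pi.posPart_apply, Pi.negPart_apply]
          rcases le_total 0 (v i) with h | h
          · simp [negPart_eq_zero.2 h]
          · simp [posPart_eq_zero.2 h]
        rw [mul_left_comm, this, mul_zero]
      · have := cartan_nonpos M hij
        nlinarith [mul_nonneg h1 h2]
  rcases key with h | h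
  · right; exact posPart_eq_zero.1 h
  · left; exact negPart_eq_zero.1 h

variable [DecidableEq B]

@[simp] lemma coroot_single (i j : B) (c : ℤ) :
    coroot M i (Pi.single j c) = cartan M i j * c := by
  simp [coroot_apply, Pi.single_apply]

/-- The simple reflection `v ↦ v - ⟨v, αᵢ⟩ αᵢ`. -/
def simpleRefl (i : B) : Module.End ℤ (B → ℤ) where
  toFun v := v - Pi.single i (coroot M i v)
  map_add' v w := by simp only [map_add, Pi.single_add]; abel
  map_smul' c v := by
    ext j
    rw [map_smul]
    by_cases h : j = i
    · subst h; simp [mul_sub]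
    · simp [h]

lemma simpleRefl_apply (i : B) (v : B → ℤ) :
    simpleRefl M i v = v - Pi.single i (coroot M i v) := rfl

lemma simpleRefl_apply_of_ne {i j : B} (h : j ≠ i) (v : B → ℤ) : simpleRefl M i v j = v j := by
  simp [simpleRefl_apply, h]

lemma simpleRefl_simpleRefl (i : B) (v : B → ℤ) : simpleRefl M i (simpleRefl M i v) = v := by
  simp only [simpleRefl_apply, map_sub, coroot_single, cartan_self]
  ext j
  by_cases h : j = i
  · subst h; simp; ring
  · simp [h]

lemma simpleRefl_single_self (i : B) (c : ℤ) :
    simpleRefl M i (Pi.single i c) = -Pi.single i c := by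
  rw [simpleRefl_apply, coroot_single, cartan_self, two_mul, Pi.single_add]
  abel

lemma normForm_single (i : B) (c : ℤ) : normForm M (Pi.single i c) = 2 * c ^ 2 := by
  rw [normForm, Finset.sum_eq_single i]
  · simp [cartan_self]; ring
  · intro j _ hj; simp [hj]
  · simp

lemma normForm_simpleRefl (i : B) (v : B → ℤ) :
    normForm M (simpleRefl M i v) = normForm M v := by
  rw [simpleRefl_apply, normForm_sub, normForm_single, sum_mul_coroot_comm,
    Finset.sum_eq_single i]
  · simp; ring
  · intro j _ hj; simp [hj]
  · simp

variable {M}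

lemma SimplyLaced.isLiftable (hM : SimplyLaced M) : M.IsLiftable (simpleRefl M) := by
  intro i j
  by_cases hij : i = j
  · subst hij
    rw [M.diagonal, pow_one]
    exact LinearMap.ext fun w => simpleRefl_simpleRefl M i w
  have hji : j ≠ i := Ne.symm hij
  have h1 : M i j ≠ 1 := M.off_diagonal i j hij
  refine LinearMap.ext fun v => ?_
  rcases hM i j with h | h | h
  · exact absurd h h1
  · have c1 : cartan M i j = 0 := by simp [cartan, h]
    have c2 : cartan M j i = 0 := by rw [cartan_symm, c1]
    rw [h, pow_two]
    simp only [Module.End.mul_apply, Module.End.one_apply, simpleRefl_apply, map_sub,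
      coroot_single, cartan_self, c1, c2]
    ext k
    by_cases hk : k = i
    · subst hk; simp [hij]; ring
    · by_cases hkj : k = j
      · subst hkj; simp [hji]; ring
      · simp [hk, hkj]
  · have c1 : cartan M i j = -1 := by simp [cartan, h]
    have c2 : cartan M j i = -1 := by rw [cartan_symm, c1]
    rw [h, pow_succ, pow_two]
    simp only [Module.End.mul_apply, Module.End.one_apply, simpleRefl_apply, map_sub,
      coroot_single, cartan_self, c1, c2]
    ext k
    by_cases hk : k = i
    · subst hk; simp [hij]; ring
    · by_cases hkj : k = j
      · subst hkj; simp [hji]; ring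
      · simp [hk, hkj]

/-- The geometric representation of a simply laced Coxeter group on its root lattice. -/
noncomputable def geomRep (cs : CoxeterSystem M W) (hM : SimplyLaced M) :
    W →* Module.End ℤ (B → ℤ) :=
  cs.lift ⟨simpleRefl M, hM.isLiftable⟩

variable (cs : CoxeterSystem M W)

@[simp] lemma geomRep_simple (hM : SimplyLaced M) (i : B) :
    geomRep cs hM (cs.simple i) = simpleRefl M i :=
  cs.lift_apply_simple hM.isLiftable i

lemma geomRep_mul_simple (hM : SimplyLaced M) (w : W) (i : B) (v : B → ℤ) :
    geomRep cs hM (w * cs.simple i) v = geomRep cs hM w (simpleRefl M i v) := by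
  simp

lemma geomRep_injective (hM : SimplyLaced M) (w : W) :
    Function.Injective (geomRep cs hM w) := by
  refine Function.LeftInverse.injective (g := geomRep cs hM w⁻¹) fun v => ?_
  rw [← Module.End.mul_apply, ← map_mul, inv_mul_cancel, map_one, Module.End.one_apply]

/-- Ascents of `w` correspond to simple roots sent by `w` to nonnegative vectors. -/
lemma geomRep_single_nonneg (hM : SimplyLaced M) (w : W) (i : B)
    (h : cs.length w < cs.length (w * cs.simple i)) :
    0 ≤ geomRep cs hM w (Pi.single i 1) := by
  induction hl : cs.length w using Nat.strong_induction_on generalizing w i with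
  | _ l ih =>
  subst hl
  by_cases hw : w = 1
  · subst hw
    simp
  obtain ⟨j, hj⟩ := cs.exists_rightDescent_of_ne_one hw
  have hij : i ≠ j := by
    rintro rfl
    exact absurd hj (by simp only [CoxeterSystem.IsRightDescent]; omega)
  have hji : j ≠ i := Ne.symm hij
  rw [CoxeterSystem.isRightDescent_iff] at hj
  obtain ⟨v, rfl⟩ : ∃ v, w = v * cs.simple j := ⟨w * cs.simple j, by simp⟩
  rw [CoxeterSystem.simple_mul_simple_cancel_right] at hj
  have hvj : 0 ≤ geomRep cs hM v (Pi.single j 1) := ih _ (by omega) v j (by omega) rfl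
  rw [geomRep_mul_simple, simpleRefl_apply, coroot_single]
  rcases hM i j with hm | hm | hm
  · exact absurd hm (M.off_diagonal i j hij)
  · have c2 : cartan M j i = 0 := by rw [cartan_symm]; simp [cartan, hm]
    rw [c2]
    simp only [zero_mul, Pi.single_zero, sub_zero]
    refine ih _ (by omega) v i ?_ rfl
    by_contra hlt
    have hcomm : v * cs.simple j * cs.simple i
        = v * cs.simple i * cs.simple j := by
      have := cs.simple_mul_simple_pow i j
      rw [hm, pow_two] at this
      have h2 : cs.simple i * cs.simple j = cs.simple j * cs.simple i := by
        rw [mul_eq_one_iff_eq_inv] at this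
        simpa [mul_inv_rev, CoxeterSystem.inv_simple] using this
      rw [mul_assoc, ← h2, mul_assoc]
    rw [hcomm] at h
    have h1 := cs.length_mul_simple v i
    have h2 := cs.length_mul_simple (v * cs.simple i) j
    omega
  · have c2 : cartan M j i = -1 := by rw [cartan_symm]; simp [cartan, hm]
    rw [c2]
    have hs : (Pi.single i 1 - Pi.single j (-1 * 1) : B → ℤ) = Pi.single i 1 + Pi.single j 1 := by
      rw [neg_one_mul, Pi.single_neg, sub_neg_eq_add]
    rw [hs, map_add]
    by_cases hvi : cs.length v < cs.length (v * cs.simple i)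
    · exact add_nonneg (ih _ (by omega) v i hvi rfl) hvj
    · obtain ⟨u, rfl⟩ : ∃ u, v = u * cs.simple i := ⟨v * cs.simple i, by simp⟩
      rw [CoxeterSystem.simple_mul_simple_cancel_right] at hvi
      have h1 := cs.length_mul_simple u i
      rw [← map_add, ← hs, ← c2, ← coroot_single, ← simpleRefl_apply,
        geomRep_mul_simple, simpleRefl_apply M j, coroot_single, c2, hs, map_add,
        simpleRefl_single_self, simpleRefl_apply M i, coroot_single]
      have c1 : cartan M i j = -1 := by simp [cartan, hm]
      rw [c1, neg_one_mul, Pi.single_neg, sub_neg_eq_add, add_comm (Pi.single j 1),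
        neg_add_cancel_left]
      refine ih _ (by omega) u j ?_ rfl
      by_contra hlt
      have hbraid : u * cs.simple i * cs.simple j * cs.simple i
          = u * cs.simple j * cs.simple i * cs.simple j := by
        have := cs.simple_mul_simple_pow i j
        rw [hm, pow_succ, pow_two] at this
        have h2 : cs.simple i * cs.simple j * cs.simple i
            = cs.simple j * cs.simple i * cs.simple j := by
          have h3 : (cs.simple i * cs.simple j * cs.simple i) *
            (cs.simple j * (cs.simple i * cs.simple j)) = 1 := by
              simpa only [mul_assoc] using this
          rw [mul_eq_one_iff_eq_inv] at h3
          simpa [mul_assoc] using h3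
        simp only [mul_assoc] at h2 ⊢
        rw [h2]
      rw [hbraid] at h
      have h2 := cs.length_mul_simple u j
      have h3 := cs.length_mul_simple (u * cs.simple j) i
      have h4 := cs.length_mul_simple (u * cs.simple j * cs.simple i) j
      omega

lemma geomRep_single_nonpos (hM : SimplyLaced M) (w : W) (i : B)
    (h : cs.IsRightDescent w i) : geomRep cs hM w (Pi.single i 1) ≤ 0 := by
  have := geomRep_single_nonneg cs hM (w * cs.simple i) i
    (by rw [CoxeterSystem.simple_mul_simple_cancel_right]; exact h)
  rw [geomRep_mul_simple, simpleRefl_single_self, map_neg] at this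
  exact neg_nonneg.1 this

lemma geomRep_apply_of_notMem (hM : SimplyLaced M) {J : Set B} {w : W}
    (hw : w ∈ parabolic cs J) (v : B → ℤ) {i : B} (hi : i ∉ J) :
    geomRep cs hM w v i = v i := by
  have hsimple : ∀ j ∈ J, ∀ v, simpleRefl M j v i = v i := fun j hj v =>
    simpleRefl_apply_of_ne M (by rintro rfl; exact hi hj) v
  induction hw using Subgroup.closure_induction generalizing v with
  | mem x hx =>
    obtain ⟨j, hj, rfl⟩ := hx
    rw [geomRep_simple]
    exact hsimple j hj v
  | one => simp
  | mul x y _ _ hx hy => rw [map_mul, Module.End.mul_apply, hx, hy]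
  | inv x _ hx =>
    rw [← hx (geomRep cs hM x⁻¹ v), ← Module.End.mul_apply, ← map_mul, mul_inv_cancel, map_one,
      Module.End.one_apply]

lemma single_mem_posRoots {J : Set B} {i : B} (hi : i ∈ J) :
    (Pi.single i 1 : B → ℤ) ∈ posRoots M J := by
  refine ⟨fun j hj => ?_, ?_, ?_⟩
  · have : j ≠ i := by rintro rfl; exact hj hi
    simp [this]
  · simp
  · simp [normForm_single]

lemma simpleRefl_mem_posRoots {J : Set B} (hJ : PosDefOn M J) {i : B} (hi : i ∈ J) {v : B → ℤ}
    (hv : v ∈ posRoots M J) (hne : v ≠ Pi.single i 1) :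
    simpleRefl M i v ∈ posRoots M J ∧ simpleRefl M i v ≠ Pi.single i 1 := by
  obtain ⟨h1, h2, h3⟩ := hv
  have h4 : ∀ j ∉ J, simpleRefl M i v j = 0 := fun j hj => by
    rw [simpleRefl_apply_of_ne M (by rintro rfl; exact hj hi), h1 j hj]
  have h5 : normForm M (simpleRefl M i v) = 2 := by rw [normForm_simpleRefl, h3]
  refine ⟨⟨h4, ?_, h5⟩, fun heq => ?_⟩
  · rcases nonneg_or_nonpos_of_normForm_eq_two M hJ h4 h5 with h | h
    · exact h
    · exfalso
      have h6 : v = Pi.single i (v i) := by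
        ext j
        by_cases hj : j = i
        · subst hj; simp
        · have := h j
          rw [simpleRefl_apply_of_ne M hj] at this
          simpa [hj] using le_antisymm this (h2 j)
      rw [h6, normForm_single] at h3
      have h7 := h2 i
      simp only [Pi.zero_apply] at h7
      have : v i = 1 := by nlinarith
      rw [this] at h6
      exact hne h6
  · have := congrArg (simpleRefl M i) heq
    rw [simpleRefl_simpleRefl, simpleRefl_single_self] at this
    have h6 := h2 i
    rw [this] at h6
    simp at h6

open Classical in
/-- The number of positive roots supported on `J` that `w` does not send to nonnegative
vectors. -/
noncomputable def numInv (hM : SimplyLaced M) {J : Set B} (hfin : (posRoots M J).Finite)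
    (w : W) : ℕ :=
  (hfin.toFinset.filter fun v => ¬ 0 ≤ geomRep cs hM w v).card

lemma numInv_mul_simple (hM : SimplyLaced M) {J : Set B} (hJ : PosDefOn M J)
    (hfin : (posRoots M J).Finite) (w : W) {i : B} (hi : i ∈ J)
    (hw : 0 ≤ geomRep cs hM w (Pi.single i 1)) :
    numInv cs hM hfin (w * cs.simple i) = numInv cs hM hfin w + 1 := by
  classical
  have hmem : (Pi.single i 1 : B → ℤ) ∈ hfin.toFinset := by
    simpa using single_mem_posRoots hi
  have hcard : ((hfin.toFinset.erase (Pi.single i 1)).filter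
        fun v => ¬ 0 ≤ geomRep cs hM (w * cs.simple i) v).card =
      ((hfin.toFinset.erase (Pi.single i 1)).filter fun v => ¬ 0 ≤ geomRep cs hM w v).card := by
    have hmaps : ∀ v ∈ hfin.toFinset.erase (Pi.single i 1),
        simpleRefl M i v ∈ hfin.toFinset.erase (Pi.single i 1) := by
      intro v hv
      rw [Finset.mem_erase, Set.Finite.mem_toFinset] at hv ⊢
      exact (simpleRefl_mem_posRoots hJ hi hv.2 hv.1).symm
    refine Finset.card_nbij' (simpleRefl M i) (simpleRefl M i) ?_ ?_ ?_ ?_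
    · intro v hv
      simp only [Finset.coe_filter, Set.mem_ofPred_eq] at hv ⊢
      exact ⟨hmaps v hv.1, by rw [← geomRep_mul_simple]; exact hv.2⟩
    · intro v hv
      simp only [Finset.coe_filter, Set.mem_ofPred_eq] at hv ⊢
      refine ⟨hmaps v hv.1, ?_⟩
      rw [geomRep_mul_simple, simpleRefl_simpleRefl]
      exact hv.2
    · exact fun v _ => simpleRefl_simpleRefl M i v
    · exact fun v _ => simpleRefl_simpleRefl M i v
  have hneg : ¬ 0 ≤ geomRep cs hM (w * cs.simple i) (Pi.single i 1) := by
    rw [geomRep_mul_simple, simpleRefl_single_self, map_neg]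
    intro h
    have h0 : geomRep cs hM w (Pi.single i 1) = 0 := le_antisymm (neg_nonneg.1 h) hw
    have := geomRep_injective cs hM w (h0.trans (map_zero _).symm)
    simp at this
  unfold numInv
  rw [← Finset.insert_erase hmem, Finset.filter_insert, Finset.filter_insert, if_pos hneg,
    if_neg (not_not.2 hw), Finset.card_insert_of_notMem (by simp), hcard]

lemma geomRep_nonpos (hM : SimplyLaced M) {J : Set B} {w : W}
    (hw : ∀ i ∈ J, geomRep cs hM w (Pi.single i 1) ≤ 0) {v : B → ℤ} (hv : 0 ≤ v)
    (hvJ : ∀ i ∉ J, v i = 0) : geomRep cs hM w v ≤ 0 := by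
  rw [← Finset.univ_sum_single v, map_sum]
  refine Finset.sum_nonpos fun i _ => ?_
  by_cases hi : i ∈ J
  · have : (Pi.single i (v i) : B → ℤ) = v i • Pi.single i 1 := by simp [← Pi.single_smul]
    rw [this, map_smul]
    exact smul_nonpos_of_nonneg_of_nonpos (hv i) (hw i hi)
  · simp [hvJ i hi]

lemma exists_isRightDescent_of_mem_parabolic (hM : SimplyLaced M) {J : Set B} {w : W}
    (hw : w ∈ parabolic cs J) (hne : w ≠ 1) : ∃ i ∈ J, cs.IsRightDescent w i := by
  obtain ⟨i, hi⟩ := cs.exists_rightDescent_of_ne_one hne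
  refine ⟨i, ?_, hi⟩
  by_contra hiJ
  have h1 := geomRep_single_nonpos cs hM w i hi i
  rw [geomRep_apply_of_notMem cs hM hw _ hiJ] at h1
  simp at h1

/-- The length of an element of `W_J` is the number of positive roots it inverts. -/
lemma length_eq_numInv (hM : SimplyLaced M) {J : Set B} (hJ : PosDefOn M J)
    (hfin : (posRoots M J).Finite) {w : W} (hw : w ∈ parabolic cs J) :
    cs.length w = numInv cs hM hfin w := by
  classical
  induction hl : cs.length w using Nat.strong_induction_on generalizing w with
  | _ l ih =>
  subst hl
  by_cases hne : w = 1
  · subst hne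
    symm
    rw [cs.length_one]
    simp only [numInv, map_one, Module.End.one_apply]
    rw [Finset.card_eq_zero, Finset.filter_eq_empty_iff]
    intro v hv
    rw [Set.Finite.mem_toFinset] at hv
    exact not_not.2 (by simpa using hv.2.1)
  · obtain ⟨i, hi, hd⟩ := exists_isRightDescent_of_mem_parabolic cs hM hw hne
    have hpos := geomRep_single_nonneg cs hM (w * cs.simple i) i
      (by rw [CoxeterSystem.simple_mul_simple_cancel_right]; exact hd)
    have h1 := numInv_mul_simple cs hM hJ hfin _ hi hpos
    rw [CoxeterSystem.simple_mul_simple_cancel_right] at h1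
    rw [h1, ← ih _ hd (mul_mem hw (simple_mem_parabolic cs hi)) rfl]
    exact (cs.isRightDescent_iff.1 hd).symm

theorem parabolic_finite (hM : SimplyLaced M) {J : Set B} (hJ : PosDefOn M J)
    (hfin : (posRoots M J).Finite) : (parabolic cs J : Set W).Finite := by
  classical
  refine (finite_setOf_length_le cs hfin.toFinset.card).subset fun w hw => ?_
  change cs.length w ≤ _
  rw [length_eq_numInv cs hM hJ hfin hw]
  exact Finset.card_filter_le _ _

lemma geomRep_w0_single_nonpos (hM : SimplyLaced M) {J : Set B}
    (h : (parabolic cs J : Set W).Finite) {i : B} (hi : i ∈ J) :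
    geomRep cs hM (w0 cs J) (Pi.single i 1) ≤ 0 := by
  obtain ⟨hmem, hmax⟩ := w0_spec cs h
  refine geomRep_single_nonpos cs hM _ i ?_
  have h1 := hmax _ (mul_mem hmem (simple_mem_parabolic cs hi))
  have h2 := cs.length_mul_simple_ne (w0 cs J) i
  exact lt_of_le_of_ne h1 h2

/-- The length of the longest element of `W_J` is the number of positive roots of `W_J`. -/
theorem length_w0 (hM : SimplyLaced M) {J : Set B} (hJ : PosDefOn M J)
    (hfin : (posRoots M J).Finite) : cs.length (w0 cs J) = (posRoots M J).ncard := by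
  classical
  have h := parabolic_finite cs hM hJ hfin
  rw [length_eq_numInv cs hM hJ hfin (w0_spec cs h).1, numInv,
    Finset.filter_true_of_mem, Set.ncard_eq_toFinset_card _ hfin]
  intro v hv hnn
  rw [Set.Finite.mem_toFinset] at hv
  have h0 := le_antisymm (geomRep_nonpos cs hM
    (fun i hi => geomRep_w0_single_nonpos cs hM h hi) hv.2.1 hv.1) hnn
  have := geomRep_injective cs hM _ (h0.trans (map_zero _).symm)
  have h2 := hv.2.2
  rw [this] at h2
  simp [normForm] at h2

/-- A nonzero nonnegative vector orthogonal to all simple roots forces the group to be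
infinite. -/
theorem parabolic_univ_infinite (hM : SimplyLaced M) {v : B → ℤ} (hv : 0 ≤ v) (hne : v ≠ 0)
    (h0 : ∀ i, coroot M i v = 0) : ¬ (parabolic cs Set.univ : Set W).Finite := by
  intro h
  have hfix : ∀ w : W, geomRep cs hM w v = v := by
    intro w
    induction w using cs.simple_induction_left with
    | one => simp
    | mul_simple_left w i hw =>
      rw [map_mul, Module.End.mul_apply, hw, geomRep_simple, simpleRefl_apply, h0]
      simp
  have h1 := geomRep_nonpos cs hM
    (fun i (hi : i ∈ Set.univ) => geomRep_w0_single_nonpos cs hM h hi) hv (by simp)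
  rw [hfix] at h1
  exact hne (le_antisymm h1 hv)

end SimplyLaced

section Transport

variable {B' : Type*} [Fintype B] [Fintype B'] {M' : CoxeterMatrix B'}

lemma normForm_comp (f : B ↪ B') {J : Set B}
    (hf : ∀ i ∈ J, ∀ j ∈ J, M' (f i) (f j) = M i j) {v : B' → ℤ}
    (hv : ∀ i ∉ f '' J, v i = 0) : normForm M (v ∘ f) = normForm M' v := by
  have hsum : ∀ g : B' → ℤ, (∀ i ∉ f '' J, g i = 0) → ∑ i, g (f i) = ∑ i, g i := by
    intro g hg
    rw [← Finset.sum_map Finset.univ f g]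
    refine Finset.sum_subset (Finset.subset_univ _) fun i _ hi => hg i ?_
    rintro ⟨j, _, rfl⟩
    simp at hi
  rw [normForm, normForm, ← hsum _ fun i hi => by rw [hv i hi, zero_mul]]
  refine Finset.sum_congr rfl fun i _ => ?_
  by_cases hi : i ∈ J
  · rw [Function.comp_apply, coroot_apply, coroot_apply,
      ← hsum _ fun j hj => by rw [hv j hj, mul_zero]]
    congr 1
    refine Finset.sum_congr rfl fun j _ => ?_
    by_cases hj : j ∈ J
    · simp only [cartan, hf i hi j hj, Function.comp_apply]
    · simp [hv (f j) (by simpa using hj)]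
  · simp [hv (f i) (by simpa using hi)]

lemma image_posRoots (f : B ↪ B') {J : Set B}
    (hf : ∀ i ∈ J, ∀ j ∈ J, M' (f i) (f j) = M i j) :
    (fun v : B' → ℤ => v ∘ f) '' posRoots M' (f '' J) = posRoots M J := by
  ext v
  constructor
  · rintro ⟨w, ⟨h1, h2, h3⟩, rfl⟩
    exact ⟨fun i hi => h1 _ (by simpa using hi), fun i => h2 _, by
      rw [normForm_comp f hf h1, h3]⟩
  · rintro ⟨h1, h2, h3⟩
    obtain ⟨w, hw, rfl⟩ := exists_comp_eq f h1
    refine ⟨w, ⟨hw, fun i => ?_, by rw [← normForm_comp f hf hw, h3]⟩, rfl⟩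
    by_cases hi : i ∈ f '' J
    · obtain ⟨j, _, rfl⟩ := hi
      exact h2 j
    · rw [hw i hi]; rfl

lemma ncard_posRoots_image (f : B ↪ B') {J : Set B}
    (hf : ∀ i ∈ J, ∀ j ∈ J, M' (f i) (f j) = M i j) :
    (posRoots M' (f '' J)).ncard = (posRoots M J).ncard := by
  rw [← image_posRoots f hf, ((comp_injOn f J).mono fun v hv => hv.1).ncard_image]

lemma PosDefOn.of_image (f : B ↪ B') {J : Set B}
    (hf : ∀ i ∈ J, ∀ j ∈ J, M' (f i) (f j) = M i j) (h : PosDefOn M' (f '' J)) :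
    PosDefOn M J := by
  intro v hv hne
  obtain ⟨w, hw, rfl⟩ := exists_comp_eq f hv
  rw [normForm_comp f hf hw]
  refine h w hw ?_
  rintro rfl
  exact hne rfl

/-- The number of positive roots is additive over orthogonal subsets. -/
lemma ncard_posRoots_union {J K : Set B} (hJK : PosDefOn M (J ∪ K)) (hd : Disjoint J K)
    (horth : ∀ i ∈ J, ∀ j ∈ K, M i j = 2) (hfin : (posRoots M (J ∪ K)).Finite) :
    (posRoots M (J ∪ K)).ncard = (posRoots M J).ncard + (posRoots M K).ncard := by
  classical
  have hsub1 : posRoots M J ⊆ posRoots M (J ∪ K) := fun v hv =>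
    ⟨fun i hi => hv.1 i fun h => hi (Or.inl h), hv.2⟩
  have hsub2 : posRoots M K ⊆ posRoots M (J ∪ K) := fun v hv =>
    ⟨fun i hi => hv.1 i fun h => hi (Or.inr h), hv.2⟩
  have hunion : posRoots M (J ∪ K) = posRoots M J ∪ posRoots M K := by
    refine Set.Subset.antisymm (fun v hv => ?_) (Set.union_subset hsub1 hsub2)
    obtain ⟨h1, h2, h3⟩ := hv
    set a : B → ℤ := fun i => if i ∈ J then v i else 0 with ha
    set b : B → ℤ := fun i => if i ∈ J then 0 else -v i with hb
    have hab : a - b = v := by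
      ext i; by_cases hi : i ∈ J <;> simp [ha, hb, hi]
    have hzero : a = 0 ∨ b = 0 := by
      refine eq_zero_or_eq_zero_of_normForm_eq_two M hJK ?_ ?_ ?_ (by rw [hab, h3])
      · intro i hi; simp only [ha]; split_ifs <;> simp [h1 i hi]
      · intro i hi; simp only [hb]; split_ifs <;> simp [h1 i hi]
      · refine Finset.sum_nonpos fun i _ => ?_
        by_cases hi : i ∈ J
        · refine le_of_eq (mul_eq_zero_of_right _ (Finset.sum_eq_zero fun j _ => ?_))
          by_cases hj : j ∈ J
          · simp [hb, hj]
          · by_cases hj' : j ∈ K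
            · simp [cartan, horth i hi j hj']
            · simp [hb, hj, h1 j (by simp [hj, hj'])]
        · simp [ha, hi]
    rcases hzero with h | h
    · right
      refine ⟨fun i hi => ?_, h2, h3⟩
      by_cases hiJ : i ∈ J
      · have := congrFun h i
        simpa [ha, hiJ] using this
      · exact h1 i (by simp [hi, hiJ])
    · left
      refine ⟨fun i hi => ?_, h2, h3⟩
      have := congrFun h i
      simpa [hb, hi] using this
  have hdisj : Disjoint (posRoots M J) (posRoots M K) := by
    rw [Set.disjoint_left]
    rintro v ⟨h1, _, h3⟩ ⟨h1', _, _⟩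
    have : v = 0 := by
      ext i
      by_cases hi : i ∈ J
      · exact h1' i (Set.disjoint_left.1 hd hi)
      · exact h1 i hi
    rw [this] at h3
    simp [normForm] at h3
  rw [hunion, Set.ncard_union_eq hdisj (hfin.subset hsub1) (hfin.subset hsub2)]

end Transport

section AffineD

lemma simplyLaced_Dmat (n : ℕ) : SimplyLaced (Dmat n) := by
  intro i j
  simp only [Dmat, Matrix.of_apply]
  split_ifs <;> simp

lemma simplyLaced_tDmat (n : ℕ) : SimplyLaced (tDmat n) := by
  intro i j
  simp only [tDmat, Matrix.of_apply]
  split_ifs <;> simp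

/-- The `m`-th coordinate of the `i`-th simple root of type `D̃ₙ` in an orthonormal basis
(modulo the radical). The roots are `e₀ + e₁`, `eᵢ - eᵢ₋₁` for `0 < i < n`, and
`-eₙ₋₂ - eₙ₋₁`, up to the sign of `e₀`. -/
def stdRoot (n i m : ℕ) : ℤ :=
  (if i = m then 1 else 0) - (if i = m + 1 then 1 else 0) +
    (if m = 1 ∧ i = 0 then 1 else 0) - (if m + 2 = n ∧ i = n then 1 else 0)

lemma sum_stdRoot_mul {n i : ℕ} (hn : 4 ≤ n) (hi : i ≤ n) (y : ℕ → ℤ) :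
    ∑ m ∈ Finset.range n, stdRoot n i m * y m =
      (if i < n then y i else 0) - (if 1 ≤ i then y (i - 1) else 0) +
        (if i = 0 then y 1 else 0) - (if i = n then y (n - 2) else 0) := by
  simp only [stdRoot, sub_mul, add_mul, ite_mul, one_mul, zero_mul, Finset.sum_sub_distrib,
    Finset.sum_add_distrib]
  congr 1
  · congr 1
    · congr 1
      · simp
      · split_ifs with h
        · rw [Finset.sum_eq_single (i - 1)]
          · rw [if_pos (by omega)]
          · intro b _ hb; rw [if_neg (by omega)]
          · intro hb; simp at hb; omega
        · exact Finset.sum_eq_zero fun b _ => if_neg (by omega)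
    · split_ifs with h
      · rw [Finset.sum_eq_single 1]
        · rw [if_pos (by omega)]
        · intro b _ hb; rw [if_neg (by omega)]
        · intro hb; simp at hb; omega
      · exact Finset.sum_eq_zero fun b _ => if_neg (by omega)
  · split_ifs with h
    · rw [Finset.sum_eq_single (n - 2)]
      · rw [if_pos (by omega)]
      · intro b _ hb; rw [if_neg (by omega)]
      · intro hb; simp at hb; omega
    · exact Finset.sum_eq_zero fun b _ => if_neg (by omega)

lemma cartan_tDmat {n : ℕ} (hn : 4 ≤ n) (i j : Fin (n + 1)) :
    cartan (tDmat n) i j = ∑ m ∈ Finset.range n, stdRoot n i m * stdRoot n j m := by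
  rw [sum_stdRoot_mul hn (by omega)]
  obtain ⟨i, hi⟩ := i
  obtain ⟨j, hj⟩ := j
  have hcartan : cartan (tDmat n) ⟨i, hi⟩ ⟨j, hj⟩ = if i = j then 2 else
      if (max i j = 2 ∧ min i j ≤ 1) ∨ (min i j + 1 = max i j ∧ 2 ≤ min i j ∧ max i j + 2 ≤ n) ∨
        (min i j + 2 = n ∧ (max i j + 1 = n ∨ max i j = n)) then -1 else 0 := by
    have key : ∀ (p q : Prop) [Decidable p] [Decidable q],
        (if (if p then 1 else if q then 3 else 2 : ℕ) = 1 then (2 : ℤ)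
          else if (if p then 1 else if q then 3 else 2 : ℕ) = 3 then -1 else 0) =
        if p then 2 else if q then -1 else 0 := by
      intro p q _ _
      split_ifs <;> simp_all
    simp only [cartan, tDmat, Matrix.of_apply, Fin.mk.injEq]
    exact key _ _
  rw [hcartan]
  clear hcartan
  simp only [stdRoot]
  rcases lt_trichotomy i j with h | rfl | h
  · rw [max_eq_right h.le, min_eq_left h.le]
    grind (splits := 30)
  · grind (splits := 30)
  · rw [max_eq_left h.le, min_eq_right h.le]
    grind (splits := 30)

/-- The coordinates of a vector of the root lattice, extended by zero to all of `ℕ`. -/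
def extend (n : ℕ) (v : Fin (n + 1) → ℤ) (t : ℕ) : ℤ := if h : t < n + 1 then v ⟨t, h⟩ else 0

lemma extend_val {n : ℕ} (v : Fin (n + 1) → ℤ) (i : Fin (n + 1)) : extend n v i = v i := by
  rw [extend, dif_pos i.is_lt]

/-- The coordinates of a vector of the root lattice of type `D̃ₙ` in an orthonormal basis
(modulo the radical). -/
def stdCoord (n : ℕ) (v : Fin (n + 1) → ℤ) (m : ℕ) : ℤ := ∑ i : Fin (n + 1), stdRoot n i m * v i

lemma stdCoord_eq {n m : ℕ} (hm : m < n) (v : Fin (n + 1) → ℤ) :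
    stdCoord n v m = extend n v m - extend n v (m + 1) + (if m = 1 then extend n v 0 else 0) -
      (if m + 2 = n then extend n v n else 0) := by
  have hsum : ∀ t < n + 1, ∑ i : Fin (n + 1), (if (i : ℕ) = t then v i else 0) = extend n v t := by
    intro t ht
    rw [Finset.sum_eq_single ⟨t, ht⟩]
    · simp [extend, ht]
    · intro b _ hb
      rw [if_neg fun h => hb (Fin.ext h)]
    · simp
  simp only [stdCoord, stdRoot, sub_mul, add_mul, ite_mul, one_mul, zero_mul,
    Finset.sum_sub_distrib, Finset.sum_add_distrib, ite_and]
  rw [hsum m (by omega), hsum (m + 1) (by omega)]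
  congr 1
  · congr 1
    split_ifs
    · exact hsum 0 (by omega)
    · simp
  · split_ifs
    · exact hsum n (by omega)
    · simp

lemma stdCoord_sub (n : ℕ) (v w : Fin (n + 1) → ℤ) (m : ℕ) :
    stdCoord n (v - w) m = stdCoord n v m - stdCoord n w m := by
  simp [stdCoord, mul_sub]

lemma coroot_tDmat {n : ℕ} (hn : 4 ≤ n) (i : Fin (n + 1)) (v : Fin (n + 1) → ℤ) :
    coroot (tDmat n) i v = ∑ m ∈ Finset.range n, stdRoot n i m * stdCoord n v m := by
  simp only [coroot_apply, cartan_tDmat hn, stdCoord, Finset.sum_mul, Finset.mul_sum]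
  rw [Finset.sum_comm]
  simp only [mul_assoc]

lemma normForm_tDmat {n : ℕ} (hn : 4 ≤ n) (v : Fin (n + 1) → ℤ) :
    normForm (tDmat n) v = ∑ m ∈ Finset.range n, stdCoord n v m ^ 2 := by
  simp only [normForm, coroot_tDmat hn, Finset.mul_sum]
  rw [Finset.sum_comm]
  refine Finset.sum_congr rfl fun m _ => ?_
  rw [pow_two]
  conv_rhs => enter [1]; rw [stdCoord]
  rw [Finset.sum_mul]
  exact Finset.sum_congr rfl fun i _ => by ring

lemma extend_eq_of_stdCoord_eq_zero {n : ℕ} (hn : 4 ≤ n) {v : Fin (n + 1) → ℤ}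
    (h : ∀ m < n, stdCoord n v m = 0) {t : ℕ} (ht : t ≤ n) :
    extend n v t = if t ≤ 1 ∨ n ≤ t + 1 then extend n v 0 else 2 * extend n v 0 := by
  have h0 := h 0 (by omega)
  have h1 := h 1 (by omega)
  have h2 := h (n - 2) (by omega)
  have h3 := h (n - 1) (by omega)
  rw [stdCoord_eq (by omega)] at h0 h1 h2 h3
  have e1 : n - 2 + 1 = n - 1 := by omega
  have e2 : n - 1 + 1 = n := by omega
  have e3 : n - 2 + 2 = n := by omega
  rw [if_neg (by omega), if_neg (by omega)] at h0
  rw [if_pos rfl, if_neg (by omega)] at h1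
  rw [if_neg (by omega), if_pos e3, e1] at h2
  rw [if_neg (by omega), if_neg (by omega), e2] at h3
  norm_num at h0 h1
  have hmid : ∀ s, 2 ≤ s → s + 2 ≤ n → extend n v s = 2 * extend n v 0 := by
    intro s hs
    induction s, hs using Nat.le_induction with
    | base => intro _; linarith
    | succ s hs ih =>
      intro hsn
      have h4 := h s (by omega)
      rw [stdCoord_eq (by omega), if_neg (by omega), if_neg (by omega)] at h4
      have := ih (by omega)
      linarith
  have h5 := hmid (n - 2) (by omega) (by omega)
  split_ifs with hc
  · have : t = 0 ∨ t = 1 ∨ t = n - 1 ∨ t = n := by omega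
    rcases this with rfl | rfl | rfl | rfl <;> linarith
  · exact hmid t (by omega) (by omega)

lemma eq_zero_of_stdCoord_eq_zero {n : ℕ} (hn : 4 ≤ n) {v : Fin (n + 1) → ℤ}
    (h : ∀ m < n, stdCoord n v m = 0) {j : Fin (n + 1)} (hj : v j = 0) : v = 0 := by
  have h0 : extend n v 0 = 0 := by
    have := extend_eq_of_stdCoord_eq_zero hn h (t := j) (by omega)
    rw [extend_val, hj] at this
    split_ifs at this <;> linarith
  ext i
  rw [← extend_val v, extend_eq_of_stdCoord_eq_zero hn h (by omega), h0]
  simp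

lemma sum_stdCoord {n : ℕ} (hn : 4 ≤ n) (v : Fin (n + 1) → ℤ) :
    ∑ m ∈ Finset.range n, stdCoord n v m = 2 * (extend n v 0 - extend n v n) := by
  have h : ∀ m ∈ Finset.range n, stdCoord n v m = (extend n v m - extend n v (m + 1)) +
      (if m = 1 then extend n v 0 else 0) - (if m = n - 2 then extend n v n else 0) := by
    intro m hm
    rw [stdCoord_eq (Finset.mem_range.1 hm)]
    have : m + 2 = n ↔ m = n - 2 := by omega
    simp only [this]
  rw [Finset.sum_congr rfl h, Finset.sum_sub_distrib, Finset.sum_add_distrib,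
    Finset.sum_range_sub']
  simp only [Finset.sum_ite_eq', Finset.mem_range]
  rw [if_pos (by omega), if_pos (by omega)]
  ring

lemma posDefOn_tDmat {n : ℕ} (hn : 4 ≤ n) {J : Set (Fin (n + 1))} (hJ : J ≠ Set.univ) :
    PosDefOn (tDmat n) J := by
  intro v hv hne
  obtain ⟨j, hj⟩ := (Set.ne_univ_iff_exists_notMem J).1 hJ
  have hpos : 0 < normForm (tDmat n) v := by
    rw [normForm_tDmat hn]
    refine lt_of_le_of_ne (Finset.sum_nonneg fun m _ => sq_nonneg _) fun h => hne ?_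
    refine eq_zero_of_stdCoord_eq_zero hn (fun m hm => ?_) (hv j hj)
    have := (Finset.sum_eq_zero_iff_of_nonneg fun m _ => sq_nonneg _).1 h.symm m
      (Finset.mem_range.2 hm)
    exact pow_eq_zero_iff two_ne_zero |>.1 this
  have heven : (2 : ℤ) ∣ normForm (tDmat n) v := by
    have h1 : normForm (tDmat n) v = ∑ m ∈ Finset.range n,
        (stdCoord n v m * (stdCoord n v m - 1)) + 2 * (extend n v 0 - extend n v n) := by
      rw [normForm_tDmat hn, ← sum_stdCoord hn, ← Finset.sum_add_distrib]
      exact Finset.sum_congr rfl fun m _ => by ring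
    rw [h1]
    exact dvd_add (Finset.dvd_sum fun m _ => (Int.even_mul_pred_self _).two_dvd) ⟨_, rfl⟩
  omega

lemma posRoots_tDmat_finite {n : ℕ} (hn : 4 ≤ n) {J : Set (Fin (n + 1))} (hJ : J ≠ Set.univ) :
    (posRoots (tDmat n) J).Finite := by
  obtain ⟨j, hj⟩ := (Set.ne_univ_iff_exists_notMem J).1 hJ
  refine Set.Finite.of_finite_image (f := fun v (m : Fin n) => stdCoord n v m)
    ((Set.finite_Icc (fun _ => -2 : Fin n → ℤ) (fun _ => 2)).subset ?_) ?_
  · rintro _ ⟨v, ⟨_, _, h⟩, rfl⟩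
    rw [normForm_tDmat hn] at h
    have hle : ∀ m : Fin n, stdCoord n v m ^ 2 ≤ 2 := fun m => by
      rw [← h]
      exact Finset.single_le_sum (f := fun m => stdCoord n v m ^ 2) (fun _ _ => sq_nonneg _)
        (Finset.mem_range.2 m.2)
    exact ⟨fun m => by have := hle m; simp only; nlinarith,
      fun m => by have := hle m; simp only; nlinarith⟩
  · intro v hv w hw h
    rw [← sub_eq_zero]
    refine eq_zero_of_stdCoord_eq_zero hn (j := j) (fun m hm => ?_) ?_
    · rw [stdCoord_sub, sub_eq_zero]
      exact congrFun h ⟨m, hm⟩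
    · simp [hv.1 j hj, hw.1 j hj]

/-- The positive generator of the radical of the norm form of type `D̃ₙ`. -/
def nullRoot (n : ℕ) (i : Fin (n + 1)) : ℤ := if (i : ℕ) ≤ 1 ∨ n ≤ i + 1 then 1 else 2

lemma coroot_nullRoot {n : ℕ} (hn : 4 ≤ n) (i : Fin (n + 1)) :
    coroot (tDmat n) i (nullRoot n) = 0 := by
  rw [coroot_tDmat hn]
  refine Finset.sum_eq_zero fun m hm => mul_eq_zero_of_right _ ?_
  have hm := Finset.mem_range.1 hm
  rw [stdCoord_eq hm]
  simp only [extend, nullRoot]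
  split_ifs <;> omega

lemma parabolic_tDmat_finite_iff {n : ℕ} (hn : 4 ≤ n) (J : Finset (Fin (n + 1))) :
    (parabolic (tDmat n).toCoxeterSystem (J : Set (Fin (n + 1))) : Set (tDmat n).Group).Finite ↔
      J ≠ Finset.univ := by
  constructor
  · rintro h rfl
    rw [Finset.coe_univ] at h
    refine parabolic_univ_infinite _ (simplyLaced_tDmat n) (v := nullRoot n) ?_ ?_
      (coroot_nullRoot hn) h
    · intro i
      simp only [nullRoot, Pi.zero_apply]
      split_ifs <;> norm_num
    · intro h0
      have := congrFun h0 0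
      simp [nullRoot] at this
  · intro h
    have hne : (J : Set (Fin (n + 1))) ≠ Set.univ := by simpa using h
    exact parabolic_finite _ (simplyLaced_tDmat n) (posDefOn_tDmat hn hne)
      (posRoots_tDmat_finite hn hne)

/-- The coefficients of the positive root `eⱼ - eᵢ` (if `i < j`) or `eⱼ + eᵢ` (if `j < i`). -/
def pairRoot (n i j : ℕ) (t : Fin (n + 1)) : ℤ :=
  if i < j then (if i < t ∧ (t : ℕ) ≤ j then 1 else 0)
  else if j = 0 then (if (t : ℕ) = 0 ∨ 2 ≤ (t : ℕ) ∧ (t : ℕ) ≤ i then 1 else 0)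
  else if (t : ℕ) ≤ 1 then 1 else if (t : ℕ) ≤ j then 2 else if (t : ℕ) ≤ i then 1 else 0

lemma pairRoot_nonneg (n i j : ℕ) : 0 ≤ pairRoot n i j := by
  intro t
  simp only [pairRoot, Pi.zero_apply]
  split_ifs <;> norm_num

lemma pairRoot_eq_zero {n i j : ℕ} {t : Fin (n + 1)} (hi : i < t) (hj : j < t) :
    pairRoot n i j t = 0 := by
  simp only [pairRoot]
  split_ifs <;> omega

lemma stdCoord_pairRoot {n i j m : ℕ} (hij : i ≠ j) (hi : i < n) (hj : j < n)
    (hm : m < n) : stdCoord n (pairRoot n i j) m =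
      (if m = j then 1 else 0) + if m = i then if i < j then -1 else 1 else 0 := by
  rw [stdCoord_eq hm]
  have hn : extend n (pairRoot n i j) n = 0 := by
    rw [extend, dif_pos (by omega)]
    exact pairRoot_eq_zero hi hj
  rw [hn, ite_self, sub_zero, extend, extend, extend, dif_pos (by omega), dif_pos (by omega),
    dif_pos (by omega)]
  simp only [pairRoot]
  rcases lt_or_gt_of_ne hij with h | h
  · simp only [if_pos h]
    split_ifs <;> omega
  · simp only [if_neg h.not_gt]
    by_cases h0 : j = 0
    · simp only [if_pos h0, Nat.add_eq_zero_iff, one_ne_zero, and_false, false_or, true_or, if_true]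
      split_ifs <;> omega
    · simp only [if_neg h0]
      split_ifs <;> omega

lemma pairRoot_injOn {n k : ℕ} (hkn : k ≤ n) :
    Set.InjOn (fun p : ℕ × ℕ => pairRoot n p.1 p.2) ((Finset.range k).offDiag : Set (ℕ × ℕ)) := by
  rintro ⟨i, j⟩ h ⟨i', j'⟩ h' heq
  simp only [Finset.coe_offDiag, Set.mem_offDiag, Finset.coe_range, Set.mem_Iio] at h h'
  have key : ∀ m < n, _ := fun m hm => (stdCoord_pairRoot h.2.2 (by omega) (by omega) hm).symm.trans
    ((congrArg (fun v => stdCoord n v m) heq).trans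
      (stdCoord_pairRoot h'.2.2 (by omega) (by omega) hm))
  have h1 := key i (by omega)
  have h2 := key j (by omega)
  have h3 := key i' (by omega)
  have h4 := key j' (by omega)
  clear key heq
  simp only [Prod.mk.injEq]
  grind

lemma exists_pair_of_sum_sq_eq_two {ι : Type*} [DecidableEq ι] {s : Finset ι} {x : ι → ℤ}
    (h : ∑ m ∈ s, x m ^ 2 = 2) : ∃ i ∈ s, ∃ j ∈ s, i ≠ j ∧ x i ^ 2 = 1 ∧ x j ^ 2 = 1 ∧
      ∀ m ∈ s, m ≠ i → m ≠ j → x m = 0 := by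
  have aux : ∀ (t : Finset ι) (c : ℤ), 0 < c → c ≤ 2 → ∑ m ∈ t, x m ^ 2 = c →
      ∃ i ∈ t, x i ^ 2 = 1 ∧ ∑ m ∈ t.erase i, x m ^ 2 = c - 1 := by
    intro t c hc hc2 ht
    obtain ⟨i, hi, hne⟩ := Finset.exists_ne_zero_of_sum_ne_zero (ht.trans_ne hc.ne')
    have hle : x i ^ 2 ≤ 2 := by
      have : x i ^ 2 ≤ _ := Finset.single_le_sum (f := fun m => x m ^ 2) (fun _ _ => sq_nonneg _) hi
      omega
    have hsq : x i ^ 2 = 1 := by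
      have h1 : -2 < x i := by nlinarith
      have h2 : x i < 2 := by nlinarith
      interval_cases h : x i <;> simp_all
    refine ⟨i, hi, hsq, ?_⟩
    have : x i ^ 2 + _ = _ := Finset.add_sum_erase t (fun m => x m ^ 2) hi
    omega
  obtain ⟨i, hi, hi1, his⟩ := aux s 2 (by norm_num) le_rfl h
  obtain ⟨j, hj, hj1, hjs⟩ := aux _ (2 - 1) (by norm_num) (by norm_num) his
  refine ⟨i, hi, j, Finset.mem_of_mem_erase hj, (Finset.ne_of_mem_erase hj).symm, hi1, hj1,
    fun m hm hmi hmj => ?_⟩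
  have := (Finset.sum_eq_zero_iff_of_nonneg fun m _ => sq_nonneg (x m)).1 (hjs.trans (by norm_num))
    m (by simp [hm, hmi, hmj])
  exact pow_eq_zero_iff two_ne_zero |>.1 this

lemma posRoots_initial {n k : ℕ} (hn : 4 ≤ n) (hk : 2 ≤ k) (hkn : k ≤ n) :
    posRoots (tDmat n) {t | (t : ℕ) < k} =
      (fun p : ℕ × ℕ => pairRoot n p.1 p.2) '' ((Finset.range k).offDiag : Set (ℕ × ℕ)) := by
  ext v
  constructor
  · rintro ⟨hv, hpos, hnorm⟩
    have hzero : ∀ t, k ≤ t → extend n v t = 0 := by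
      intro t ht
      rw [extend]
      split_ifs with h
      · exact hv _ (by simpa using ht)
      · rfl
    have hnorm' := hnorm
    rw [normForm_tDmat hn] at hnorm
    obtain ⟨a, ha, b, hb, hab, ha1, hb1, hz⟩ := exists_pair_of_sum_sq_eq_two hnorm
    rw [Finset.mem_range] at ha hb
    have hlt : ∀ m < n, stdCoord n v m ^ 2 = 1 → m < k := by
      intro m hm h
      by_contra! hmk
      rw [stdCoord_eq hm, hzero m hmk, hzero (m + 1) (by omega), hzero n hkn,
        if_neg (by omega)] at h
      simp at h
    have hak := hlt a ha ha1
    have hbk := hlt b hb hb1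
    have key : ∃ i j, i < k ∧ j < k ∧ i ≠ j ∧
        ((∀ m < n, stdCoord n v m = stdCoord n (pairRoot n i j) m) ∨
          (∀ m < n, stdCoord n v m = -stdCoord n (pairRoot n i j) m)) := by
      wlog hlt' : a < b generalizing a b
      · exact this b hb a ha hab.symm hb1 ha1 (fun m hm h1 h2 => hz m hm h2 h1) hbk hak
          (by omega)
      rcases sq_eq_one_iff.1 ha1 with h1 | h1 <;>
        rcases sq_eq_one_iff.1 hb1 with h2 | h2
      · refine ⟨b, a, hbk, hak, by omega, Or.inl ?_⟩
        intro m hm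
        rw [stdCoord_pairRoot (by omega) (by omega) (by omega) hm]
        by_cases hma : m = a
        · subst hma
          split_ifs <;> omega
        · by_cases hmb : m = b
          · subst hmb
            split_ifs <;> omega
          · rw [hz m (Finset.mem_range.2 hm) hma hmb]
            simp [hma, hmb]
      · refine ⟨a, b, hak, hbk, by omega, Or.inr ?_⟩
        intro m hm
        rw [stdCoord_pairRoot (by omega) (by omega) (by omega) hm]
        by_cases hma : m = a
        · subst hma
          split_ifs <;> omega
        · by_cases hmb : m = b
          · subst hmb
            split_ifs <;> omega
          · rw [hz m (Finset.mem_range.2 hm) hma hmb]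
            simp [hma, hmb]
      · refine ⟨a, b, hak, hbk, by omega, Or.inl ?_⟩
        intro m hm
        rw [stdCoord_pairRoot (by omega) (by omega) (by omega) hm]
        by_cases hma : m = a
        · subst hma
          split_ifs <;> omega
        · by_cases hmb : m = b
          · subst hmb
            split_ifs <;> omega
          · rw [hz m (Finset.mem_range.2 hm) hma hmb]
            simp [hma, hmb]
      · refine ⟨b, a, hbk, hak, by omega, Or.inr ?_⟩
        intro m hm
        rw [stdCoord_pairRoot (by omega) (by omega) (by omega) hm]
        by_cases hma : m = a
        · subst hma
          split_ifs <;> omega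
        · by_cases hmb : m = b
          · subst hmb
            split_ifs <;> omega
          · rw [hz m (Finset.mem_range.2 hm) hma hmb]
            simp [hma, hmb]
    obtain ⟨i, j, hi, hj, hij, h⟩ := key
    refine ⟨(i, j), by simp [hi, hj, hij], ?_⟩
    have hlast : v (Fin.last n) = 0 := hv _ (by simpa using hkn)
    have hlast' : pairRoot n i j (Fin.last n) = 0 :=
      pairRoot_eq_zero (by simp; omega) (by simp; omega)
    rcases h with h | h
    · refine (sub_eq_zero.1 (eq_zero_of_stdCoord_eq_zero hn (j := Fin.last n) ?_ ?_)).symm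
      · intro m hm
        rw [stdCoord_sub, h m hm, sub_self]
      · simp [hlast, hlast']
    · have hneg : pairRoot n i j - (-v) = 0 := by
        refine eq_zero_of_stdCoord_eq_zero hn (j := Fin.last n) ?_ ?_
        · intro m hm
          rw [stdCoord_sub, ← zero_sub v, stdCoord_sub, h m hm]
          simp [stdCoord]
        · simp [hlast, hlast']
      have hv0 : v = 0 := by
        refine le_antisymm (fun t => ?_) hpos
        have h1 := congrFun hneg t
        have h2 := pairRoot_nonneg n i j t
        simp only [Pi.sub_apply, Pi.neg_apply, Pi.zero_apply] at h1 h2 ⊢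
        omega
      simp [hv0, normForm] at hnorm'
  · rintro ⟨⟨i, j⟩, h, rfl⟩
    simp only [Finset.coe_offDiag, Set.mem_offDiag, Finset.coe_range, Set.mem_Iio] at h
    obtain ⟨hi, hj, hij⟩ := h
    refine ⟨fun t ht => ?_, pairRoot_nonneg n i j, ?_⟩
    · have : k ≤ t := by simpa using ht
      exact pairRoot_eq_zero (by omega) (by omega)
    · have hsub : ({i, j} : Finset ℕ) ⊆ Finset.range n := by
        intro m
        simp only [Finset.mem_insert, Finset.mem_singleton, Finset.mem_range]
        omega
      rw [normForm_tDmat hn, ← Finset.sum_subset hsub, Finset.sum_pair hij,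
        stdCoord_pairRoot hij (by omega) (by omega) (by omega),
        stdCoord_pairRoot hij (by omega) (by omega) (by omega)]
      · simp only [if_neg hij, if_neg hij.symm, if_true]
        split_ifs <;> norm_num
      · intro m hm hm'
        simp only [Finset.mem_insert, Finset.mem_singleton, not_or] at hm'
        rw [stdCoord_pairRoot hij (by omega) (by omega) (Finset.mem_range.1 hm), if_neg hm'.1,
          if_neg hm'.2]
        norm_num

lemma ncard_posRoots_initial {n k : ℕ} (hn : 4 ≤ n) (hk : 2 ≤ k) (hkn : k ≤ n) :
    (posRoots (tDmat n) {t | (t : ℕ) < k}).ncard = k * (k - 1) := by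
  rw [posRoots_initial hn hk hkn, (pairRoot_injOn hkn).ncard_image, Set.ncard_coe_finset,
    Finset.offDiag_card, Finset.card_range, Nat.mul_sub_one]

open Finset in
lemma sum_erase_univ_eq_sum_Iio_union {α β : Type*} [Fintype α] [LinearOrder α]
    [LocallyFiniteOrder α] [LocallyFiniteOrderBot α] [LocallyFiniteOrderTop α]
    [AddCommMonoid β] (f : Finset α → β) :
    ∑ J ∈ univ.erase univ, f J = ∑ k, ∑ J ∈ (Ioi k).powerset, f (Iio k ∪ J) := by
  rw [sum_sigma' univ (fun k => (Ioi k).powerset)]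
  symm
  have hlow : ∀ {k : α} {J : Finset α}, J ⊆ Ioi k → k ∉ Iio k ∪ J := by
    intro k J hJ
    simpa using fun h => lt_irrefl k (mem_Ioi.1 (hJ h))
  refine sum_bij (fun p _ => Iio p.1 ∪ p.2) ?_ ?_ ?_ fun _ _ => rfl
  · rintro ⟨k, J⟩ h
    simp only [mem_sigma, mem_univ, mem_powerset, true_and] at h
    exact mem_erase.2 ⟨fun heq => hlow h (heq ▸ mem_univ k), mem_univ _⟩
  · rintro ⟨k, J⟩ h ⟨k', J'⟩ h' heq
    simp only [mem_sigma, mem_univ, mem_powerset, true_and] at h h' heq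
    have hk : k = k' := by
      rcases lt_trichotomy k k' with hlt | hlt | hlt
      · exact absurd (heq ▸ mem_union_left _ (mem_Iio.2 hlt)) (hlow h)
      · exact hlt
      · exact absurd (heq ▸ mem_union_left _ (mem_Iio.2 hlt)) (hlow h')
    subst hk
    congr 1
    have hrec : ∀ {J : Finset α}, J ⊆ Ioi k → J = (Iio k ∪ J).filter (k < ·) := by
      intro J hJ
      ext x
      simp only [mem_filter, mem_union, mem_Iio]
      exact ⟨fun hx => ⟨Or.inr hx, mem_Ioi.1 (hJ hx)⟩,
        fun hx => hx.1.resolve_left (not_lt_of_gt hx.2)⟩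
    rw [hrec h, hrec h', heq]
  · intro J hJ
    have hne : Jᶜ.Nonempty := by
      rw [nonempty_iff_ne_empty, Ne, compl_eq_empty_iff]
      exact (mem_erase.1 hJ).1
    have hmin := min'_mem _ hne
    rw [mem_compl] at hmin
    refine ⟨⟨Jᶜ.min' hne, J.filter (Jᶜ.min' hne < ·)⟩, ?_, ?_⟩
    · simp only [mem_sigma, mem_univ, mem_powerset, true_and]
      exact fun x hx => mem_Ioi.2 (mem_filter.1 hx).2
    · ext x
      simp only [mem_union, mem_Iio, mem_filter]
      constructor
      · rintro (hx | hx)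
        · by_contra hxJ
          exact not_le_of_gt hx (min'_le _ _ (mem_compl.2 hxJ))
        · exact hx.1
      · intro hx
        rcases lt_trichotomy x (Jᶜ.min' hne) with hlt | heq | hlt
        · exact Or.inl hlt
        · exact absurd (heq ▸ hx) hmin
        · exact Or.inr ⟨hx, hlt⟩

/-- The number of positive roots of type `D̃ₙ` supported on `J`. -/
noncomputable def numPosRoots (n : ℕ) (J : Finset (Fin (n + 1))) : ℕ :=
  (posRoots (tDmat n) (J : Set (Fin (n + 1)))).ncard

/-- The contribution of `J` to the modified characteristic polynomial of type `D̃ₙ`. -/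
noncomputable def charTerm (n : ℕ) (J : Finset (Fin (n + 1))) : ℤ[X] :=
  (-1) ^ J.card * X ^ numPosRoots n J

lemma chiAffD_eq {n : ℕ} (hn : 4 ≤ n) :
    chiAffD n = ∑ J ∈ Finset.univ.erase Finset.univ, charTerm n J := by
  have hset : {J : Finset (Fin (n + 1)) |
      ((parabolic (tDmat n).toCoxeterSystem (↑J : Set (Fin (n + 1)))) :
        Set (tDmat n).Group).Finite} =
      ((Finset.univ.erase Finset.univ : Finset (Finset (Fin (n + 1)))) :
        Set (Finset (Fin (n + 1)))) := by
    ext J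
    simpa using parabolic_tDmat_finite_iff hn J
  rw [chiAffD, hset, finsum_mem_coe_finset]
  refine Finset.sum_congr rfl fun J hJ => ?_
  have hJ' : (J : Set (Fin (n + 1))) ≠ Set.univ := by simpa using hJ
  rw [length_w0 _ (simplyLaced_tDmat n) (posDefOn_tDmat hn hJ') (posRoots_tDmat_finite hn hJ'),
    charTerm, numPosRoots]

lemma numPosRoots_map {n : ℕ} (e : Equiv.Perm (Fin (n + 1)))
    (he : ∀ i j, tDmat n (e i) (e j) = tDmat n i j) (J : Finset (Fin (n + 1))) :
    numPosRoots n (J.map e.toEmbedding) = numPosRoots n J := by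
  rw [numPosRoots, Finset.coe_map]
  exact ncard_posRoots_image e.toEmbedding fun i _ j _ => he i j

/-- The embedding of the diagram of type `Dₙ₋ₖ` as the last vertices of the one of type `D̃ₙ`. -/
def tailEmb (n k : ℕ) : Fin (n - k) ↪ Fin (n + 1) where
  toFun i := ⟨i + k + 1, by omega⟩
  inj' i j h := by
    simp only [Fin.mk.injEq] at h
    omega

lemma val_tailEmb {n k : ℕ} (i : Fin (n - k)) : (tailEmb n k i : ℕ) = i + k + 1 := rfl

lemma tDmat_tailEmb {n k : ℕ} (hn : 4 ≤ n) (i j : Fin (n - k)) :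
    tDmat n (tailEmb n k i) (tailEmb n k j) = Dmat (n - k) i j := by
  simp only [tDmat, Dmat, Matrix.of_apply, val_tailEmb, EmbeddingLike.apply_eq_iff_eq]
  by_cases h : i = j
  · rw [if_pos h, if_pos h]
  · have h' := Fin.val_ne_of_ne h
    rw [if_neg h, if_neg h]
    refine if_congr ?_ rfl rfl
    rcases le_total (i : ℕ) j with hle | hle <;>
      simp only [hle, add_le_add_iff_right, max_eq_left, max_eq_right, min_eq_left,
        min_eq_right] <;> omega

lemma map_tailEmb {n k : ℕ} (hk : k < n + 1) :
    Finset.univ.map (tailEmb n k) = Finset.Ioi (⟨k, hk⟩ : Fin (n + 1)) := by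
  ext i
  simp only [Finset.mem_map, Finset.mem_univ, true_and, Finset.mem_Ioi]
  constructor
  · rintro ⟨j, rfl⟩
    rw [Fin.lt_def, val_tailEmb]
    exact Nat.lt_succ_of_le (Nat.le_add_left k j)
  · intro h
    have h : k < i := h
    refine ⟨⟨i - k - 1, by omega⟩, Fin.ext ?_⟩
    rw [val_tailEmb]
    exact (by omega : (i : ℕ) - k - 1 + k + 1 = i)

lemma lenD_eq {n k : ℕ} (hn : 4 ≤ n) (J : Finset (Fin (n - k))) :
    lenD (n - k) J = numPosRoots n (J.map (tailEmb n k)) := by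
  have hf : ∀ i ∈ (J : Set (Fin (n - k))), ∀ j ∈ (J : Set (Fin (n - k))),
      tDmat n (tailEmb n k i) (tailEmb n k j) = Dmat (n - k) i j :=
    fun i _ j _ => tDmat_tailEmb hn i j
  have hne : tailEmb n k '' (J : Set (Fin (n - k))) ≠ Set.univ := by
    refine (Set.ne_univ_iff_exists_notMem _).2 ⟨0, ?_⟩
    rintro ⟨i, _, hi⟩
    simpa [val_tailEmb] using congrArg Fin.val hi
  rw [lenD, length_w0 _ (simplyLaced_Dmat _) (PosDefOn.of_image _ hf (posDefOn_tDmat hn hne))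
    (image_posRoots _ hf ▸ (posRoots_tDmat_finite hn hne).image _), numPosRoots, Finset.coe_map,
    ncard_posRoots_image _ hf]

lemma chiD_eq {n k : ℕ} (hn : 4 ≤ n) (hk : k + 2 ≤ n) :
    chiD (n - k) = ∑ J ∈ (Finset.Ioi (⟨k, by omega⟩ : Fin (n + 1))).powerset, charTerm n J := by
  rw [chiD, if_neg (by omega), ← map_tailEmb]
  refine Finset.sum_bij (fun J _ => J.map (tailEmb n k)) ?_ ?_ ?_ ?_
  · intro J _
    exact Finset.mem_powerset.2 (Finset.map_subset_map.2 (Finset.subset_univ J))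
  · intro J _ J' _ h
    exact Finset.map_injective _ h
  · intro J hJ
    obtain ⟨u, -, rfl⟩ := Finset.subset_map_iff.1 (Finset.mem_powerset.1 hJ)
    exact ⟨u, Finset.mem_univ u, rfl⟩
  · intro J _
    rw [charTerm, Finset.card_map, lenD_eq hn]

lemma numPosRoots_Iio {n k : ℕ} (hn : 4 ≤ n) (hk : 2 ≤ k) (hkn : k ≤ n) :
    numPosRoots n (Finset.Iio ⟨k, by omega⟩) = k * (k - 1) := by
  rw [← ncard_posRoots_initial hn hk hkn, numPosRoots, Finset.coe_Iio]
  rfl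

lemma charTerm_Iio {n k : ℕ} (hn : 4 ≤ n) (hk : 2 ≤ k) (hkn : k ≤ n) :
    charTerm n (Finset.Iio ⟨k, by omega⟩) = (-1) ^ k * X ^ (k * (k - 1)) := by
  rw [charTerm, numPosRoots_Iio hn hk hkn, Fin.card_Iio]

lemma charTerm_Iio_union {n k : ℕ} (hn : 4 ≤ n) (hk : 2 ≤ k) (hkn : k + 2 ≤ n)
    {J : Finset (Fin (n + 1))} (hJ : J ⊆ Finset.Ioi ⟨k, by omega⟩) :
    charTerm n (Finset.Iio ⟨k, by omega⟩ ∪ J) = (-1) ^ k * X ^ (k * (k - 1)) * charTerm n J := by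
  have hJ' : ∀ i ∈ J, k < i := fun i hi => Fin.lt_def.1 (Finset.mem_Ioi.1 (hJ hi))
  have hd : Disjoint (Finset.Iio (⟨k, by omega⟩ : Fin (n + 1))) J := by
    rw [Finset.disjoint_left]
    intro i hi hiJ
    have h1 : (i : ℕ) < k := Fin.lt_def.1 (Finset.mem_Iio.1 hi)
    have h2 := hJ' i hiJ
    omega
  have hne : ((Finset.Iio (⟨k, by omega⟩ : Fin (n + 1)) : Set (Fin (n + 1))) ∪ J) ≠ Set.univ := by
    refine (Set.ne_univ_iff_exists_notMem _).2 ⟨⟨k, by omega⟩, ?_⟩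
    rintro (h | h)
    · simp at h
    · exact lt_irrefl _ (hJ' _ h)
  have hunion : numPosRoots n (Finset.Iio ⟨k, by omega⟩ ∪ J) =
      numPosRoots n (Finset.Iio ⟨k, by omega⟩) + numPosRoots n J := by
    rw [numPosRoots, Finset.coe_union]
    refine ncard_posRoots_union (posDefOn_tDmat hn hne) (Finset.disjoint_coe.2 hd) ?_
      (posRoots_tDmat_finite hn hne)
    intro i hi j hj
    have h1 : (i : ℕ) < k := Fin.lt_def.1 (Finset.mem_Iio.1 (Finset.mem_coe.1 hi))
    have h2 := hJ' j hj
    simp only [tDmat, Matrix.of_apply, Fin.ext_iff]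
    rw [if_neg (by omega), if_neg (by omega)]
  rw [charTerm, hunion, Finset.card_union_of_disjoint hd, numPosRoots_Iio hn hk (by omega),
    Fin.card_Iio, charTerm]
  ring

lemma tDmat_swap {n : ℕ} (hn : 4 ≤ n) {a b : Fin (n + 1)}
    (hab : (a : ℕ) = 0 ∧ (b : ℕ) = 1 ∨ (a : ℕ) + 1 = n ∧ (b : ℕ) = n) (i j : Fin (n + 1)) :
    tDmat n (Equiv.swap a b i) (Equiv.swap a b j) = tDmat n i j := by
  have hval : ∀ i : Fin (n + 1), (i : ℕ) = a ∧ (Equiv.swap a b i : ℕ) = b ∨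
      (i : ℕ) = b ∧ (Equiv.swap a b i : ℕ) = a ∨
      (i : ℕ) ≠ a ∧ (i : ℕ) ≠ b ∧ (Equiv.swap a b i : ℕ) = i := by
    intro i
    rw [Equiv.swap_apply_def]
    split_ifs with h1 h2
    · exact Or.inl ⟨congrArg _ h1, rfl⟩
    · exact Or.inr (Or.inl ⟨congrArg _ h2, rfl⟩)
    · exact Or.inr (Or.inr ⟨Fin.val_ne_of_ne h1, Fin.val_ne_of_ne h2, rfl⟩)
  simp only [tDmat, Matrix.of_apply, EmbeddingLike.apply_eq_iff_eq]
  by_cases h : i = j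
  · rw [if_pos h, if_pos h]
  · have h' := Fin.val_ne_of_ne h
    rw [if_neg h, if_neg h]
    refine if_congr ?_ rfl rfl
    have hi := hval i
    have hj := hval j
    generalize ((Equiv.swap a b i : Fin (n + 1)) : ℕ) = i' at *
    generalize ((Equiv.swap a b j : Fin (n + 1)) : ℕ) = j' at *
    rcases le_total (i : ℕ) j with hle | hle <;> rcases le_total i' j' with hle' | hle' <;>
      simp only [hle, hle', max_eq_left, max_eq_right, min_eq_left, min_eq_right] <;>
      rcases hi with hi | hi | hi <;> rcases hj with hj | hj | hj <;>
      rcases hab with hab | hab <;> (constructor <;> intro h <;> omega)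

lemma charTerm_insert_swap {n : ℕ} (hn : 4 ≤ n) {a b : Fin (n + 1)}
    (hab : (a : ℕ) = 0 ∧ (b : ℕ) = 1 ∨ (a : ℕ) + 1 = n ∧ (b : ℕ) = n)
    {J : Finset (Fin (n + 1))} (ha : a ∉ J) (hb : b ∉ J) :
    charTerm n (insert a J) = charTerm n (insert b J) := by
  have hmap : (insert a J).map (Equiv.swap a b).toEmbedding = insert b J := by
    rw [Finset.map_insert, Equiv.coe_toEmbedding, Equiv.swap_apply_left, Finset.map_eq_image,
      Finset.image_congr (g := id), Finset.image_id]
    intro x hx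
    exact Equiv.swap_apply_of_ne_of_ne (ne_of_mem_of_not_mem hx ha) (ne_of_mem_of_not_mem hx hb)
  rw [charTerm, charTerm, ← hmap, numPosRoots_map _ (tDmat_swap hn hab), Finset.card_map]

lemma sum_charTerm_zero {n : ℕ} (hn : 4 ≤ n) :
    ∑ J ∈ (Finset.Ioi (⟨0, by omega⟩ : Fin (n + 1))).powerset,
      charTerm n (Finset.Iio ⟨0, by omega⟩ ∪ J) = chiD n := by
  have h : Finset.Iio (⟨0, by omega⟩ : Fin (n + 1)) = ∅ := by
    ext i
    simp
  simp only [h, Finset.empty_union]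
  exact (chiD_eq hn (k := 0) (by omega)).symm

lemma sum_charTerm_one {n : ℕ} (hn : 4 ≤ n) :
    ∑ J ∈ (Finset.Ioi (⟨1, by omega⟩ : Fin (n + 1))).powerset,
      charTerm n (Finset.Iio ⟨1, by omega⟩ ∪ J) = chiD n - chiD (n - 1) := by
  have hIio : Finset.Iio (⟨1, by omega⟩ : Fin (n + 1)) = {⟨0, by omega⟩} := by
    ext i
    simp only [Finset.mem_Iio, Finset.mem_singleton, Fin.lt_def, Fin.ext_iff]
    omega
  have hIoi : Finset.Ioi (⟨0, by omega⟩ : Fin (n + 1)) =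
      insert ⟨1, by omega⟩ (Finset.Ioi ⟨1, by omega⟩) := by
    ext i
    simp only [Finset.mem_Ioi, Finset.mem_insert, Fin.lt_def, Fin.ext_iff]
    omega
  have h0 : chiD n = _ := chiD_eq hn (k := 0) (by omega)
  rw [hIoi, Finset.sum_powerset_insert (by simp), ← chiD_eq hn (by omega)] at h0
  rw [eq_sub_iff_add_eq, add_comm, h0]
  congr 1
  refine Finset.sum_congr rfl fun J hJ => ?_
  rw [hIio, Finset.singleton_union]
  have hJ := Finset.mem_powerset.1 hJ
  refine charTerm_insert_swap hn (Or.inl ⟨rfl, rfl⟩) (fun h => ?_) (fun h => ?_)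
  · exact absurd (Finset.mem_Ioi.1 (hJ h)) (by simp)
  · exact absurd (Finset.mem_Ioi.1 (hJ h)) (by simp)

lemma sum_charTerm_mid {n k : ℕ} (hn : 4 ≤ n) (hk : 2 ≤ k) (hkn : k + 2 ≤ n) :
    ∑ J ∈ (Finset.Ioi (⟨k, by omega⟩ : Fin (n + 1))).powerset,
      charTerm n (Finset.Iio ⟨k, by omega⟩ ∪ J) =
        (-1) ^ k * X ^ (k * (k - 1)) * chiD (n - k) := by
  rw [chiD_eq hn hkn, Finset.mul_sum]
  exact Finset.sum_congr rfl fun J hJ => charTerm_Iio_union hn hk hkn (Finset.mem_powerset.1 hJ)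

lemma sum_charTerm_last {n : ℕ} (hn : 4 ≤ n) :
    ∑ J ∈ (Finset.Ioi (⟨n, by omega⟩ : Fin (n + 1))).powerset,
      charTerm n (Finset.Iio ⟨n, by omega⟩ ∪ J) = (-1) ^ n * X ^ (n * (n - 1)) := by
  have h : Finset.Ioi (⟨n, by omega⟩ : Fin (n + 1)) = ∅ := by
    ext i
    simp only [Finset.mem_Ioi, Fin.lt_def, Finset.notMem_empty, iff_false]
    omega
  rw [h, Finset.powerset_empty, Finset.sum_singleton, Finset.union_empty,
    charTerm_Iio hn (by omega) le_rfl]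

lemma sum_charTerm_pred {n : ℕ} (hn : 4 ≤ n) :
    ∑ J ∈ (Finset.Ioi (⟨n - 1, by omega⟩ : Fin (n + 1))).powerset,
      charTerm n (Finset.Iio ⟨n - 1, by omega⟩ ∪ J) =
        (-1) ^ (n - 1) * X ^ ((n - 1) * (n - 1 - 1)) + (-1) ^ n * X ^ (n * (n - 1)) := by
  have hIoi : Finset.Ioi (⟨n - 1, by omega⟩ : Fin (n + 1)) = insert ⟨n, by omega⟩ ∅ := by
    ext i
    simp only [Finset.mem_Ioi, Fin.lt_def, Finset.mem_insert, Finset.notMem_empty, or_false,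
      Fin.ext_iff]
    omega
  have hIio : Finset.Iio (⟨n, by omega⟩ : Fin (n + 1)) =
      insert ⟨n - 1, by omega⟩ (Finset.Iio ⟨n - 1, by omega⟩) := by
    ext i
    simp only [Finset.mem_Iio, Fin.lt_def, Finset.mem_insert, Fin.ext_iff]
    omega
  have hlast := charTerm_Iio hn (by omega) (le_refl n)
  rw [hIio, charTerm_insert_swap hn (b := ⟨n, by omega⟩)
    (Or.inr ⟨Nat.sub_add_cancel (by omega), rfl⟩) (by simp) (by simp [Fin.lt_def])] at hlast
  rw [hIoi, Finset.sum_powerset_insert (by simp), Finset.powerset_empty, Finset.sum_singleton,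
    Finset.sum_singleton, Finset.union_empty, charTerm_Iio hn (by omega) (by omega), ← hlast,
    Finset.union_insert, Finset.union_empty]

lemma chiAffD_eq_sum {n : ℕ} (hn : 4 ≤ n) :
    chiAffD n = ∑ k ∈ Finset.range (n + 1),
      ((-1 : ℤ[X]) ^ k * X ^ (k * (k - 1)) * chiD (n - k) + (if k = 1 then chiD n else 0) +
        if k = n - 1 then (-1) ^ n * X ^ (n * (n - 1)) else 0) := by
  rw [chiAffD_eq hn, sum_erase_univ_eq_sum_Iio_union, Finset.sum_range]
  refine Finset.sum_congr rfl ?_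
  rintro ⟨k, hk⟩ -
  have h0 : chiD 0 = 1 := if_pos (by omega)
  have h1 : chiD 1 = 1 := if_pos (by omega)
  obtain rfl | rfl | ⟨hk2, hkn⟩ | rfl | rfl :
    k = 0 ∨ k = 1 ∨ (2 ≤ k ∧ k + 2 ≤ n) ∨ k = n - 1 ∨ k = n := by omega
  · rw [sum_charTerm_zero hn, if_neg (by norm_num), if_neg (by simp only; omega)]
    simp
  · rw [sum_charTerm_one hn, if_pos rfl, if_neg (by simp only; omega)]
    simp only [pow_one, Nat.sub_self, mul_zero, pow_zero]
    ring
  · rw [sum_charTerm_mid hn hk2 hkn, if_neg (by simp only; omega), if_neg (by simp only; omega)]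
    simp
  · rw [sum_charTerm_pred hn, if_neg (by simp only; omega), if_pos rfl]
    simp only [Nat.sub_sub_self (by omega : 1 ≤ n), h1]
    ring
  · rw [sum_charTerm_last hn, if_neg (by simp only; omega), if_neg (by simp only; omega)]
    simp [h0]

end AffineD

/-- for `n ≥ 4`, every proper parabolic subgroup of `D̃ₙ` is finite
(hence `χ̂_{D̃ₙ}` is a polynomial), and
`χ̂_{D̃ₙ}(q) = χ̂_{Dₙ}(q) + (-1)^n q^(n(n-1)) + Σ_{k=0}^{n} (-1)^k q^(k(k-1)) χ̂_{D_{n-k}}(q)`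
(with `χ̂_{D_i} = 1` for `i ≤ 1`). -/
theorem chiAff_tD (n : ℕ) (hn : 4 ≤ n) :
    (∀ J : Finset (Fin (n + 1)), J ≠ Finset.univ →
      ((parabolic (tDmat n).toCoxeterSystem (↑J : Set (Fin (n + 1)))) :
        Set (tDmat n).Group).Finite) ∧
    chiAffD n = chiD n + (-1 : Polynomial ℤ) ^ n * X ^ (n * (n - 1)) +
      ∑ k ∈ Finset.range (n + 1),
        (-1 : Polynomial ℤ) ^ k * X ^ (k * (k - 1)) * chiD (n - k) := by
  refine ⟨fun J hJ => (parabolic_tDmat_finite_iff hn J).2 hJ, ?_⟩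
  rw [chiAffD_eq_sum hn, Finset.sum_add_distrib, Finset.sum_add_distrib, Finset.sum_ite_eq',
    Finset.sum_ite_eq', if_pos (Finset.mem_range.2 (by omega)),
    if_pos (Finset.mem_range.2 (by omega))]
  ring

end CoxeterCharPoly
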